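/- Let p, q be coprime positive integers. Then the sum over all pairs of nonzero integers (k₁, k₂) with q ∤ k₁, q ∤ k₂, and q | (k₁ + k₂·p), of 1/(k₁²·k₂²), equals (π⁴/q⁴)·∑_{r=1}^{q−1} 1/(sin²(πr/q)·sin²(πrp/q)). -/

import Mathlib

open Real

lemma csc_sq_unit (x : ℝ) (h0 : 0 < x) (h1 : x < 1) :
    HasSum (fun n : ℤ => 1 / (x + n) ^ 2) (π ^ 2 / Real.sin (π * x) ^ 2) := by
  obtain ⟨ρ, hxρ, hρ1⟩ := exists_between h1
  have hρ0 : 0 < ρ := h0.trans hxρ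
  have hc : 0 < 1 - ρ := by linarith
  let F : ℕ → ℂ → ℂ := fun n w => 1 / (w - (n + 1)) + 1 / (w + (n + 1))
  have hnorm : ∀ n : ℕ, ‖((n : ℂ) + 1)‖ = n + 1 := by
    intro n
    have : ((n : ℂ) + 1) = ((n + 1 : ℕ) : ℂ) := by push_cast; rfl
    rw [this, Complex.norm_natCast]; push_cast; rfl
  have lb1 : ∀ (n : ℕ) (w : ℂ), ‖w‖ < ρ → (1 - ρ) * (n + 1) ≤ ‖w - (n + 1)‖ := by
    intro n w hw
    have := norm_sub_norm_le ((n : ℂ) + 1) w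
    rw [hnorm, norm_sub_rev] at this
    have hn : (0 : ℝ) ≤ n := Nat.cast_nonneg n
    nlinarith
  have lb2 : ∀ (n : ℕ) (w : ℂ), ‖w‖ < ρ → (1 - ρ) * (n + 1) ≤ ‖w + (n + 1)‖ := by
    intro n w hw
    have := lb1 n (-w) (by simpa using hw)
    rwa [show -w - ((n : ℂ) + 1) = -(w + (n + 1)) by ring, norm_neg] at this
  have pos : ∀ n : ℕ, 0 < (1 - ρ) * ((n : ℝ) + 1) := fun n => by positivity
  have ne1 : ∀ (n : ℕ) (w : ℂ), ‖w‖ < ρ → w - (n + 1) ≠ 0 := fun n w hw =>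
    norm_pos_iff.mp ((pos n).trans_le (lb1 n w hw))
  have ne2 : ∀ (n : ℕ) (w : ℂ), ‖w‖ < ρ → w + (n + 1) ≠ 0 := fun n w hw =>
    norm_pos_iff.mp ((pos n).trans_le (lb2 n w hw))
  have hx : ‖(x : ℂ)‖ < ρ := by
    rw [Complex.norm_real, Real.norm_eq_abs, abs_of_pos h0]; exact hxρ
  have hder : ∀ (n : ℕ) (w : ℂ), ‖w‖ < ρ →
      HasDerivAt (F n) (-1 / (w - (n + 1)) ^ 2 + -1 / (w + (n + 1)) ^ 2) w := by
    intro n w hw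
    have a := ((hasDerivAt_id w).sub_const ((n : ℂ) + 1)).inv (ne1 n w hw)
    have b := ((hasDerivAt_id w).add_const ((n : ℂ) + 1)).inv (ne2 n w hw)
    have := a.add b
    simpa [F, Function.comp_def, Pi.add_def] using this
  have hu : Summable (fun n : ℕ => (2 / (1 - ρ) ^ 2) * (1 / ((n : ℝ) + 1) ^ 2)) := by
    apply Summable.mul_left
    have := (summable_nat_add_iff 1).mpr (Real.summable_one_div_nat_pow.mpr (one_lt_two))
    simpa using this
  have key := Complex.hasSum_deriv_of_summable_norm (U := Metric.ball 0 ρ) (F := F) (z := (x : ℂ))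
    hu (fun n w hw => (hder n w (by simpa using hw)).differentiableAt.differentiableWithinAt)
    Metric.isOpen_ball
    (by
      intro n w hw
      have hw : ‖w‖ < ρ := by simpa using hw
      have e : F n w = 2 * w / ((w - (n + 1)) * (w + (n + 1))) := by
        have := ne1 n w hw
        have := ne2 n w hw
        simp only [F]; field_simp; ring
      rw [e, norm_div, norm_mul, norm_mul]
      calc ‖(2 : ℂ)‖ * ‖w‖ / (‖w - (n + 1)‖ * ‖w + (n + 1)‖)
          ≤ 2 * 1 / (((1 - ρ) * (n + 1)) * ((1 - ρ) * (n + 1))) := by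
            have := pos n
            have := lb1 n w hw
            have := lb2 n w hw
            have : ‖w‖ ≤ 1 := by linarith
            have : ‖(2 : ℂ)‖ ≤ 2 := by simp
            gcongr
        _ = _ := by have := pos n; field_simp)
    (by simpa using hx)
  have hmem : (x : ℂ) ∈ Complex.integerComplement := by
    rintro ⟨n, hn⟩
    have hn' : (n : ℝ) = x := by exact_mod_cast hn
    rw [← hn'] at h0 h1
    have : 0 < n := by exact_mod_cast h0
    have : n < 1 := by exact_mod_cast h1
    omega
  have hsin : Complex.sin (π * x) ≠ 0 := sin_pi_mul_ne_zero hmem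
  have hx0 : (x : ℂ) ≠ 0 := by exact_mod_cast h0.ne'
  have hlim : deriv (fun w => ∑' n, F n w) (x : ℂ) =
      -(π ^ 2 / Complex.sin (π * x) ^ 2) + 1 / (x : ℂ) ^ 2 := by
    have ev : (fun w => ∑' n, F n w) =ᶠ[nhds (x : ℂ)]
        fun w => π * (Complex.cos (π * w) / Complex.sin (π * w)) - w⁻¹ := by
      filter_upwards [Complex.isOpen_compl_range_intCast.mem_nhds hmem] with w hw
      rw [← one_div, ← cot_series_rep' hw, Complex.cot]
    rw [ev.deriv_eq]
    have m : HasDerivAt (fun w : ℂ => (π : ℂ) * w) π (x : ℂ) := by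
      simpa using (hasDerivAt_id (x : ℂ)).const_mul (π : ℂ)
    have := ((m.ccos.div m.csin hsin).const_mul (π : ℂ)).sub (hasDerivAt_inv hx0)
    refine (this.congr_deriv ?_).deriv
    have := Complex.sin_sq_add_cos_sq (π * x)
    field_simp
    linear_combination (-(π : ℂ) ^ 2 * x ^ 2) * this
  rw [hlim] at key
  have key2 : HasSum (fun n : ℕ => 1 / (x + ((n : ℝ) + 1)) ^ 2 + 1 / (x - ((n : ℝ) + 1)) ^ 2)
      (π ^ 2 / Real.sin (π * x) ^ 2 - 1 / x ^ 2) := by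
    rw [← Complex.hasSum_ofReal]
    convert! key.neg using 1
    · funext n
      rw [(hder n x hx).deriv]; push_cast; ring
    · push_cast; ring
  have hadd : Summable (fun n : ℕ => 1 / (x + ((n : ℝ) + 1)) ^ 2) :=
    key2.summable.of_nonneg_of_le (fun n => by positivity)
      (fun n => by have : 0 ≤ 1 / (x - ((n : ℝ) + 1)) ^ 2 := by positivity
                   linarith)
  have hsub : Summable (fun n : ℕ => 1 / (x - ((n : ℝ) + 1)) ^ 2) :=
    key2.summable.of_nonneg_of_le (fun n => by positivity)
      (fun n => by have : 0 ≤ 1 / (x + ((n : ℝ) + 1)) ^ 2 := by positivity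
                   linarith)
  have e := key2.unique (hadd.hasSum.add hsub.hasSum)
  have := HasSum.of_add_one_of_neg_add_one (f := fun n : ℤ => 1 / (x + n) ^ 2)
    (by simpa using hadd.hasSum) (by simpa [sub_eq_add_neg, add_comm] using hsub.hasSum)
  convert! this using 1
  simp only [Int.cast_zero, add_zero, one_div] at e ⊢
  simp only [sub_eq_add_neg, neg_add_rev] at e ⊢
  first | linarith | (simp only [add_comm] at e ⊢; linarith)

lemma csc_sq (x : ℝ) (h : ∀ n : ℤ, x ≠ n) :
    HasSum (fun n : ℤ => 1 / (x + n) ^ 2) (π ^ 2 / Real.sin (π * x) ^ 2) := by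
  have h0 : 0 < Int.fract x := by
    refine lt_of_le_of_ne (Int.fract_nonneg x) (fun h' => h ⌊x⌋ ?_)
    have := Int.fract_add_floor x
    rw [← h'] at this; linarith
  have := csc_sq_unit _ h0 (Int.fract_lt_one x)
  rw [← (Equiv.addRight ⌊x⌋).hasSum_iff] at this
  convert! this using 1
  · funext n
    simp only [Function.comp, Equiv.coe_addRight, Int.fract]; push_cast; ring_nf
  · have : π * Int.fract x = π * x - ⌊x⌋ * π := by rw [Int.fract]; ring
    rw [this, Real.sin_sub_int_mul_pi, mul_pow]
    have h2 : (((-1 : ℝ) ^ ⌊x⌋) ^ 2) = 1 := by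
      rw [← zpow_natCast, ← zpow_mul, mul_comm ⌊x⌋, zpow_mul]
      simp
    rw [h2, one_mul]

lemma pair_sum (p q r : ℤ) (hq : 2 ≤ q) (h1 : ¬ q ∣ r) (h2 : ¬ q ∣ r * p) :
    HasSum (fun n : ℤ × ℤ => 1 / (((n.1 * q - r * p : ℤ) : ℝ) ^ 2 * ((r + n.2 * q : ℤ) : ℝ) ^ 2))
      ((π ^ 4 / (q : ℝ) ^ 4) *
        (1 / (Real.sin (π * r / q) ^ 2 * Real.sin (π * r * p / q) ^ 2))) := by
  have hq0 : (q : ℝ) ≠ 0 := by exact_mod_cast (by omega : q ≠ 0)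
  have nonint : ∀ a : ℤ, ¬ q ∣ a → ∀ n : ℤ, ((a : ℝ) / q) ≠ n := by
    intro a ha n hn
    rw [div_eq_iff hq0] at hn
    exact ha ⟨n, by rw [mul_comm]; exact_mod_cast hn⟩
  have A := csc_sq _ (nonint r h1)
  have B := csc_sq _ (nonint (-(r * p)) (by rwa [dvd_neg]))
  have C := (B.mul A (B.summable.mul_of_nonneg A.summable
    (fun n => by positivity) (fun n => by positivity))).mul_left
    (1 / (q : ℝ) ^ 4)
  convert! C using 1
  · funext n
    have e1 : ((-(r * p) : ℤ) : ℝ) / q + n.1 = ((n.1 * q - r * p : ℤ) : ℝ) / q := by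
      push_cast; field_simp; ring
    have e2 : (r : ℝ) / q + n.2 = ((r + n.2 * q : ℤ) : ℝ) / q := by
      push_cast; field_simp
    rw [e1, e2]
    simp only [div_pow, one_div_div, one_div, inv_div, mul_inv]
    field_simp
  · have e1 : π * (((-(r * p) : ℤ) : ℝ) / q) = -(π * r * p / q) := by push_cast; ring
    rw [e1, Real.sin_neg, neg_sq, ← mul_div_assoc]
    simp only [div_eq_mul_inv, mul_inv]
    ring

theorem lattice_sum_identity (p q : ℤ) (hp : 0 < p) (hq : 2 ≤ q)
    (hpq : IsCoprime p q) :
    ∑' k : {k : ℤ × ℤ // k.1 ≠ 0 ∧ k.2 ≠ 0 ∧ ¬ (q ∣ k.1) ∧ ¬ (q ∣ k.2) ∧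
        q ∣ (k.1 + k.2 * p)},
      1 / ((k.val.1 : ℝ) ^ 2 * (k.val.2 : ℝ) ^ 2)
    = (π ^ 4 / (q : ℝ) ^ 4) * ∑ r ∈ Finset.Icc (1 : ℤ) (q - 1),
        1 / (Real.sin (π * r / q) ^ 2 * Real.sin (π * r * p / q) ^ 2) := by
  have hr : ∀ r ∈ Finset.Icc (1 : ℤ) (q - 1), ¬ q ∣ r := by
    intro r hr h
    rw [Finset.mem_Icc] at hr
    have := Int.le_of_dvd (by omega) h
    omega
  have hmul : ∀ r : ℤ, ¬ q ∣ r → ¬ q ∣ r * p := fun r h h' =>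
    h (hpq.symm.dvd_of_dvd_mul_right h')
  let T := (_ : Finset.Icc (1 : ℤ) (q - 1)) × (ℤ × ℤ)
  let S := {k : ℤ × ℤ // k.1 ≠ 0 ∧ k.2 ≠ 0 ∧ ¬ (q ∣ k.1) ∧ ¬ (q ∣ k.2) ∧
        q ∣ (k.1 + k.2 * p)}
  have hk1 : ∀ t : T, ¬ q ∣ (t.2.1 * q - t.1.1 * p) := fun t h =>
    hmul _ (hr _ t.1.2) ((dvd_sub_right (Dvd.intro_left _ rfl)).mp h)
  have hk2 : ∀ t : T, ¬ q ∣ (t.1.1 + t.2.2 * q) := fun t h =>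
    hr _ t.1.2 ((dvd_add_left (Dvd.intro_left _ rfl)).mp h)
  let f : T → S := fun t => ⟨(t.2.1 * q - t.1.1 * p, t.1.1 + t.2.2 * q),
    fun h => hk1 t (by simp only at h; rw [h]; exact dvd_zero q),
    fun h => hk2 t (by simp only at h; rw [h]; exact dvd_zero q), hk1 t, hk2 t,
    ⟨t.2.1 + t.2.2 * p, by ring⟩⟩
  have hf : Function.Bijective f := by
    constructor
    · rintro ⟨⟨r, hr⟩, m, n⟩ ⟨⟨r', hr'⟩, m', n'⟩ h
      have h := congrArg Subtype.val h
      simp only [f, Prod.mk.injEq] at h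
      obtain ⟨ha, hb⟩ := h
      rw [Finset.mem_Icc] at hr hr'
      have : r = r' := by
        have := congrArg (· % q) hb
        simp only [Int.add_mul_emod_self_right] at this
        rwa [Int.emod_eq_of_lt (by omega) (by omega), Int.emod_eq_of_lt (by omega) (by omega)]
          at this
      subst this
      have hn : n = n' := mul_right_cancel₀ (by omega : q ≠ 0) (by linarith)
      have hm : m = m' := mul_right_cancel₀ (by omega : q ≠ 0) (by linarith)
      subst hn hm; rfl
    · rintro ⟨⟨a, b⟩, ha, hb, ha', hb', c, hc⟩
      simp only at ha hb ha' hb' hc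
      have h0 := Int.emod_nonneg b (by omega : q ≠ 0)
      have h1 := Int.emod_lt_of_pos b (by omega : 0 < q)
      have h2 : b % q ≠ 0 := fun h => hb' (Int.dvd_of_emod_eq_zero h)
      have h3 := Int.emod_add_mul_ediv b q
      refine ⟨⟨⟨b % q, Finset.mem_Icc.mpr ⟨by omega, by omega⟩⟩, c - b / q * p, b / q⟩, ?_⟩
      apply Subtype.ext
      simp only [f, Prod.mk.injEq]
      constructor
      · linear_combination -hc - p * h3
      · linear_combination h3
  rw [← (Equiv.ofBijective f hf).tsum_eq]
  have hs := fun r : Finset.Icc (1 : ℤ) (q - 1) =>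
    pair_sum p q r.1 hq (hr _ r.2) (hmul _ (hr _ r.2))
  have hsum : Summable (fun t : T =>
      1 / (((t.2.1 * q - t.1.1 * p : ℤ) : ℝ) ^ 2 * ((t.1.1 + t.2.2 * q : ℤ) : ℝ) ^ 2)) := by
    rw [summable_sigma_of_nonneg (fun t => by positivity)]
    exact ⟨fun r => (hs r).summable, (hasSum_fintype _).summable⟩
  have := (hsum.hasSum.sigma hs).unique (hasSum_fintype _)
  refine Eq.trans this ?_
  rw [Finset.mul_sum]
  exact Finset.sum_coe_sort (Finset.Icc (1 : ℤ) (q - 1)) (fun r : ℤ => π ^ 4 / (q : ℝ) ^ 4 *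
    (1 / (Real.sin (π * r / q) ^ 2 * Real.sin (π * r * p / q) ^ 2)))
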